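/- Let C be a 2-CNF formula over a finite set V of Boolean variables. If for every variable v ∈ V it is not the case that both (¬v is reachable from v) and (v is reachable from ¬v) in the implication graph of C, then C is satisfiable: there exists an assignment σ : V → Bool satisfying C. Combined with the converse direction, C is satisfiable if and only if no variable v has v and ¬v mutually reachable in the implication graph. -/

import Mathlib

/-- A literal over the variable set `V`: a variable together with a polarity
(`true` = the variable itself, `false` = its negation). -/
abbrev Lit (V : Type*) := V × Bool

/-- Negation of a literal. -/
def Lit.neg {V : Type*} (l : Lit V) : Lit V := (l.1, !l.2)

/-- Evaluation of a literal under an assignment. -/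
def Lit.eval {V : Type*} (σ : V → Bool) (l : Lit V) : Bool :=
  if l.2 then σ l.1 else !(σ l.1)

/-- An assignment satisfies a 2-CNF formula (a finite set of two-literal
clauses) if every clause contains a true literal. -/
def Satisfies {V : Type*} (σ : V → Bool) (C : Finset (Lit V × Lit V)) : Prop :=
  ∀ p ∈ C, Lit.eval σ p.1 = true ∨ Lit.eval σ p.2 = true

/-- The arc relation of the implication graph of a 2-CNF formula: each clause
`{l₁, l₂}` contributes the arcs `¬l₁ → l₂` and `¬l₂ → l₁`. -/
def Arc {V : Type*} (C : Finset (Lit V × Lit V)) (a b : Lit V) : Prop :=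
  ∃ p ∈ C, (a = Lit.neg p.1 ∧ b = p.2) ∨ (a = Lit.neg p.2 ∧ b = p.1)

/-- Reachability in the implication graph (reflexive-transitive closure). -/
def Reach {V : Type*} (C : Finset (Lit V × Lit V)) : Lit V → Lit V → Prop :=
  Relation.ReflTransGen (Arc C)

theorem Lit.neg_neg {V : Type*} (l : Lit V) : l.neg.neg = l := by
  simp [Lit.neg]

theorem Lit.eval_neg {V : Type*} (σ : V → Bool) (l : Lit V) :
    Lit.eval σ l.neg = !Lit.eval σ l := by
  obtain ⟨v, _ | _⟩ := l <;> simp [Lit.neg, Lit.eval]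

theorem Arc.contrapose {V : Type*} {C : Finset (Lit V × Lit V)} {a b : Lit V}
    (h : Arc C a b) : Arc C b.neg a.neg := by
  obtain ⟨p, hp, ⟨rfl, rfl⟩ | ⟨rfl, rfl⟩⟩ := h
  · exact ⟨p, hp, Or.inr ⟨rfl, Lit.neg_neg _⟩⟩
  · exact ⟨p, hp, Or.inl ⟨rfl, Lit.neg_neg _⟩⟩

theorem Reach.contrapose {V : Type*} {C : Finset (Lit V × Lit V)} {a b : Lit V}
    (h : Reach C a b) : Reach C b.neg a.neg := by
  induction h with
  | refl => exact Relation.ReflTransGen.refl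
  | tail _ hbc ih => exact Relation.ReflTransGen.head hbc.contrapose ih

theorem Satisfies.eval_of_reach {V : Type*} {C : Finset (Lit V × Lit V)} {σ : V → Bool}
    (hσ : Satisfies σ C) {a b : Lit V} (h : Reach C a b) (ha : Lit.eval σ a = true) :
    Lit.eval σ b = true := by
  induction h with
  | refl => exact ha
  | tail _ hbc ih =>
    obtain ⟨p, hp, ⟨rfl, rfl⟩ | ⟨rfl, rfl⟩⟩ := hbc <;>
    · rw [Lit.eval_neg] at ih
      have := hσ p hp
      simp_all

/-- A set of literals that is closed under implication and contains no complementary pair. -/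
def IsConsistentClosed {V : Type*} (C : Finset (Lit V × Lit V)) (S : Set (Lit V)) : Prop :=
  (∀ a ∈ S, ∀ b, Reach C a b → b ∈ S) ∧ ∀ a ∈ S, a.neg ∉ S

theorem IsConsistentClosed.union_reach {V : Type*} {C : Finset (Lit V × Lit V)}
    {S : Set (Lit V)} (hS : IsConsistentClosed C S) {l : Lit V} (hl : ¬ Reach C l l.neg)
    (hlS : l.neg ∉ S) : IsConsistentClosed C (S ∪ {m | Reach C l m}) := by
  refine ⟨?_, ?_⟩
  · rintro a (ha | ha) b hab
    · exact Or.inl (hS.1 a ha b hab)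
    · exact Or.inr (Relation.ReflTransGen.trans ha hab)
  · rintro a (ha | ha) (hna | hna)
    · exact hS.2 a ha hna
    · have h : Reach C l a.neg := hna
      have h' := h.contrapose
      rw [Lit.neg_neg] at h'
      exact hlS (hS.1 a ha _ h')
    · exact hlS (hS.1 _ hna _ (Reach.contrapose ha))
    · have h : Reach C l a.neg := hna
      have h' := h.contrapose
      rw [Lit.neg_neg] at h'
      exact hl (Relation.ReflTransGen.trans ha h')

theorem exists_complete_isConsistentClosed {V : Type*} [Finite V]
    {C : Finset (Lit V × Lit V)} (h : ∀ l : Lit V, ¬ (Reach C l l.neg ∧ Reach C l.neg l)) :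
    ∃ S, IsConsistentClosed C S ∧ ∀ l : Lit V, l ∈ S ∨ l.neg ∈ S := by
  obtain ⟨S, hS⟩ := (Set.toFinite {S | IsConsistentClosed C S}).exists_maximal
    ⟨∅, by simp [IsConsistentClosed]⟩
  have key : ∀ l : Lit V, ¬ Reach C l l.neg → l.neg ∉ S → l ∈ S := fun l hl hlS =>
    hS.2 (hS.1.union_reach hl hlS) Set.subset_union_left (Or.inr Relation.ReflTransGen.refl)
  refine ⟨S, hS.1, fun l => ?_⟩
  by_contra! hl
  by_cases hr : Reach C l l.neg
  · refine hl.2 (key l.neg ?_ ?_) <;> rw [Lit.neg_neg]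
    · exact fun hr' => h l ⟨hr, hr'⟩
    · exact hl.1
  · exact hl.1 (key l hr hl.2)

theorem IsConsistentClosed.exists_satisfies {V : Type*} {C : Finset (Lit V × Lit V)}
    {S : Set (Lit V)} (hS : IsConsistentClosed C S) (hc : ∀ l : Lit V, l ∈ S ∨ l.neg ∈ S) :
    ∃ σ : V → Bool, Satisfies σ C := by
  classical
  refine ⟨fun v => decide ((v, true) ∈ S), fun p hp => ?_⟩
  have heval : ∀ l ∈ S, Lit.eval (fun v => decide ((v, true) ∈ S)) l = true := by
    rintro ⟨v, _ | _⟩ hl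
    · simpa [Lit.eval, Lit.neg] using hS.2 _ hl
    · simpa [Lit.eval] using hl
  rcases hc p.1 with h | h
  · exact Or.inl (heval _ h)
  · exact Or.inr (heval _ (hS.1 _ h _
      (Relation.ReflTransGen.single ⟨p, hp, Or.inl ⟨rfl, rfl⟩⟩)))

/-- A 2-CNF formula over a finite variable set is satisfiable iff no variable
`v` is such that `v` and `¬v` are mutually reachable in the implication
graph. -/
theorem satisfiable_iff_no_mutual_reach {V : Type*} [Fintype V]
    (C : Finset (Lit V × Lit V)) :
    (∃ σ : V → Bool, Satisfies σ C) ↔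
      ∀ v : V, ¬ (Reach C (v, true) (v, false) ∧ Reach C (v, false) (v, true)) := by
  constructor
  · rintro ⟨σ, hσ⟩ v ⟨h₁, h₂⟩
    have h₁' := hσ.eval_of_reach h₁
    have h₂' := hσ.eval_of_reach h₂
    cases hv : σ v <;> simp [Lit.eval, hv] at h₁' h₂'
  · intro h
    obtain ⟨S, hS, hc⟩ := exists_complete_isConsistentClosed (C := C) (by
      rintro ⟨v, _ | _⟩ ⟨h₁, h₂⟩
      · exact h v ⟨h₂, h₁⟩
      · exact h v ⟨h₁, h₂⟩)
    exact hS.exists_satisfies hc
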